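/- arXiv:2002.08894 — 2 statements merged into one kernel-verified Lean document; each statement's English description precedes it below -/
import Mathlib

section
/- Let X and Y be finite subsets of ℝ with |X| ≥ 3 and |Y| ≥ 3. Then there exists a pointwise finite-dimensional persistence module M over the product poset X × Y such that: (1) M is not interval-decomposable; (2) for every subgrid X' × Y' ⊊ X × Y with |X'| < min(|X|, |Y|) or |Y'| < min(|X|, |Y|), the restriction of M to X' × Y' is interval-decomposable. -/
open CategoryTheory Limits Set

noncomputable section

set_option linter.unusedSectionVars false

attribute [local instance] Classical.propDecidable

namespace PersistencePaper

/-- A persistence module over a poset `P`, with coefficients in a field `k`: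
a functor from `P` (viewed as a category) to the category of `k`-vector spaces. -/
abbrev PersistenceModule (k : Type) [Field k] (P : Type) [Preorder P] : Type 1 :=
  P ⥤ ModuleCat k

variable (k : Type) [Field k]

section Indicator

variable {P : Type} [Preorder P]

/-- The fiber of the indicator module of a set `Q ⊆ P` at a point `t : P`,
realized as a submodule of `k`: it is all of `k` when `t ∈ Q` and `0` otherwise. -/
def indSub (Q : Set P) (t : P) : Submodule k k where
  carrier := {x | t ∉ Q → x = 0}
  add_mem' := by intro a b ha hb ht; rw [ha ht, hb ht, add_zero]
  zero_mem' := fun _ => rfl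
  smul_mem' := by intro c x hx ht; rw [hx ht, smul_zero]

/-- The structure map of the indicator module: the identity when both endpoints lie in
`Q`, and zero otherwise. -/
def indMap (Q : Set P) (s t : P) : indSub k Q s →ₗ[k] indSub k Q t where
  toFun x := ⟨if s ∈ Q ∧ t ∈ Q then (x : k) else 0, by
    intro ht
    split_ifs with h
    · exact absurd h.2 ht
    · rfl⟩
  map_add' x y := by apply Subtype.ext; split_ifs <;> simp
  map_smul' c x := by apply Subtype.ext; split_ifs <;> simp

theorem indMap_coe (Q : Set P) (s t : P) (x : indSub k Q s) :
    (indMap k Q s t x : k) = if s ∈ Q ∧ t ∈ Q then (x : k) else 0 := rfl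

/-- The indicator persistence module `k_Q` of a convex subset `Q` of a poset `P`:
it assigns `k` to points of `Q` and `0` elsewhere, the structure maps being the identity
between points of `Q` and zero otherwise. -/
def indicator (Q : Set P) (hQ : Q.OrdConnected) : PersistenceModule k P where
  obj t := ModuleCat.of k (indSub k Q t)
  map {s t} _ := ModuleCat.ofHom (indMap k Q s t)
  map_id t := by
    refine ModuleCat.hom_ext <| LinearMap.ext fun x => Subtype.ext ?_
    show (indMap k Q t t x).val = Subtype.val x
    rw [indMap_coe]
    split_ifs with h
    · rfl
    · exact (x.2 fun ht => h ⟨ht, ht⟩).symm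
  map_comp {s t u} f g := by
    refine ModuleCat.hom_ext <| LinearMap.ext fun x => Subtype.ext ?_
    show (indMap k Q s u x).val = (indMap k Q t u (indMap k Q s t x)).val
    rw [indMap_coe, indMap_coe, indMap_coe]
    by_cases hs : s ∈ Q <;> by_cases hu : u ∈ Q
    · have ht : t ∈ Q := hQ.out hs hu ⟨leOfHom f, leOfHom g⟩
      simp [hs, ht, hu]
    · simp [hs, hu]
    · simp [hs, hu]
    · simp [hs, hu]

/-- The structure map `ρ_s^t : M_s → M_t` of a persistence module, as a linear map. -/
def rho (M : PersistenceModule k P) {s t : P} (h : s ≤ t) : M.obj s →ₗ[k] M.obj t :=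
  (M.map (homOfLE h)).hom

/-- The rank invariant `r(s,t)` of a persistence module: the rank of `ρ_s^t` when `s ≤ t`,
and `0` (by convention) otherwise. -/
def rk (M : PersistenceModule k P) (s t : P) : ℕ :=
  if h : s ≤ t then Module.finrank k (LinearMap.range (rho k M h)) else 0

/-- A persistence module is pointwise finite-dimensional (pfd) if all its spaces are
finite-dimensional. -/
def Pfd (M : PersistenceModule k P) : Prop :=
  ∀ t : P, FiniteDimensional k (M.obj t)

/-- An interval of a poset: a nonempty, convex and zigzag-connected subset. -/
def IsInterval (Q : Set P) : Prop :=
  Q.Nonempty ∧ Q.OrdConnected ∧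
    ∀ p ∈ Q, ∀ q ∈ Q,
      Relation.ReflTransGen (fun a b => a ∈ Q ∧ b ∈ Q ∧ (a ≤ b ∨ b ≤ a)) p q

/-- A persistence module is interval-decomposable if it is isomorphic to a direct sum
of indicator modules of intervals. -/
def IntervalDecomposable (M : PersistenceModule k P) : Prop :=
  ∃ (ι : Type) (I : ι → Set P) (hI : ∀ i, IsInterval (I i)),
    Nonempty (M ≅ ∐ fun i => indicator k (I i) (hI i).2.1)

end Indicator

section Rect

variable {X Y : Type} [Preorder X] [Preorder Y]

/-- A rectangle in the product poset `X × Y`: a nonempty product `I ×ˢ J` of an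
interval (convex subset) of `X` with an interval of `Y`. -/
def IsRectangle (R : Set (X × Y)) : Prop :=
  R.Nonempty ∧ ∃ (I : Set X) (J : Set Y), I.OrdConnected ∧ J.OrdConnected ∧ R = I ×ˢ J

theorem IsRectangle.ordConnected {R : Set (X × Y)} (h : IsRectangle R) :
    R.OrdConnected := by
  obtain ⟨-, I, J, hI, hJ, rfl⟩ := h
  constructor
  intro x hx y hy z hz
  exact ⟨hI.out hx.1 hy.1 ⟨hz.1.1, hz.2.1⟩, hJ.out hx.2 hy.2 ⟨hz.1.2, hz.2.2⟩⟩

/-- A persistence bimodule is rectangle-decomposable if it is isomorphic to a direct sum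
of indicator (rectangle) modules of rectangles. -/
def RectangleDecomposable (M : PersistenceModule k (X × Y)) : Prop :=
  ∃ (ι : Type) (R : ι → Set (X × Y)) (hR : ∀ i, IsRectangle (R i)),
    Nonempty (M ≅ ∐ fun i => indicator k (R i) (hR i).ordConnected)

/-- A persistence bimodule `M` over `X × Y` is weakly exact if for all `s ≤ t`,
`Im ρ_s^t = Im ρ_{(t₁,s₂)}^t ∩ Im ρ_{(s₁,t₂)}^t` and
`Ker ρ_s^t = Ker ρ_s^{(t₁,s₂)} + Ker ρ_s^{(s₁,t₂)}`. -/
def WeaklyExact (M : PersistenceModule k (X × Y)) : Prop :=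
  ∀ (s t : X × Y) (h : s ≤ t),
    (LinearMap.range (rho k M h) =
        LinearMap.range (rho k M (show (t.1, s.2) ≤ t from ⟨le_refl t.1, h.2⟩)) ⊓
        LinearMap.range (rho k M (show (s.1, t.2) ≤ t from ⟨h.1, le_refl t.2⟩))) ∧
    (LinearMap.ker (rho k M h) =
        LinearMap.ker (rho k M (show s ≤ (t.1, s.2) from ⟨h.1, le_refl s.2⟩)) ⊔
        LinearMap.ker (rho k M (show s ≤ (s.1, t.2) from ⟨le_refl s.1, h.2⟩)))

/-- The space (fiber) of a persistence module at an index. -/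
abbrev fiber {k : Type} [Field k] {P : Type} [Preorder P]
    (M : PersistenceModule k P) (t : P) : ModuleCat k :=
  M.obj t

/-- Morphisms of persistence modules (natural transformations). -/
abbrev PMHom {k : Type} [Field k] {P : Type} [Preorder P]
    (M N : PersistenceModule k P) : Type :=
  M ⟶ N

/-- The component of a morphism of persistence modules at an index, as a linear map. -/
abbrev PMHom.appLin {k : Type} [Field k] {P : Type} [Preorder P]
    {M N : PersistenceModule k P} (f : PMHom M N) (t : P) :
    M.obj t →ₗ[k] N.obj t :=
  (f.app t).hom

/-- The restriction of a persistence module to a subset of its indexing poset. -/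
def restrict {P : Type} [Preorder P] (M : PersistenceModule k P) (S : Set P) :
    PersistenceModule k ↥S :=
  (show Monotone (Subtype.val : ↥S → P) from fun _ _ h => h).functor ⋙ M

/-- The pullback (restriction) of a persistence module along a monotone map of posets. -/
def restrictAlong {P R : Type} [Preorder P] [Preorder R] {f : R → P} (hf : Monotone f)
    (M : PersistenceModule k P) : PersistenceModule k R :=
  hf.functor ⋙ M

/-- The right Kan extension of a persistence module along a monotone map of posets. -/
def ranAlong {P R : Type} [Preorder P] [Preorder R] {f : P → R} (hf : Monotone f)
    (M : PersistenceModule k P) : PersistenceModule k R :=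
  hf.functor.ran.obj M

/-- `M` decomposes as a direct sum of indicator modules whose supports are drawn from
the family `A` of (convex) subsets of the indexing poset. -/
def DecomposesWithSupports {P : Type} [Preorder P] (M : PersistenceModule k P)
    (A : Set (Set P)) : Prop :=
  ∃ (ι : Type) (Q : ι → Set P) (_ : ∀ i, Q i ∈ A) (hconv : ∀ i, (Q i).OrdConnected),
    Nonempty (M ≅ ∐ fun i => indicator k (Q i) (hconv i))

end Rect

end PersistencePaper
namespace PersistencePaper

section Aux

variable (k : Type) [Field k]

/-- Connected component of `p` in `Q`. -/
def zcomp {P : Type} [Preorder P] (Q : Set P) (p : P) : Set P :=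
  {q | Relation.ReflTransGen (fun a b => a ∈ Q ∧ b ∈ Q ∧ (a ≤ b ∨ b ≤ a)) p q}

theorem zcomp_subset {P : Type} [Preorder P] {Q : Set P} {p : P} (hp : p ∈ Q) :
    zcomp Q p ⊆ Q := by
  intro q hq
  induction hq with
  | refl => exact hp
  | tail _ h _ => exact h.2.1

theorem zrel_symm {P : Type} [Preorder P] {Q : Set P} {p q : P}
    (h : Relation.ReflTransGen (fun a b => a ∈ Q ∧ b ∈ Q ∧ (a ≤ b ∨ b ≤ a)) p q) :
    Relation.ReflTransGen (fun a b => a ∈ Q ∧ b ∈ Q ∧ (a ≤ b ∨ b ≤ a)) q p := by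
  induction h with
  | refl => exact .refl
  | tail _ h ih => exact .head ⟨h.2.1, h.1, h.2.2.symm⟩ ih

theorem zcomp_eq {P : Type} [Preorder P] {Q : Set P} {p q : P} (h : q ∈ zcomp Q p) :
    zcomp Q p = zcomp Q q := by
  ext r
  exact ⟨fun hr => (zrel_symm h).trans hr, fun hr => Relation.ReflTransGen.trans h hr⟩

theorem zcomp_eq_of_le {P : Type} [Preorder P] {Q : Set P} {p q : P} (hp : p ∈ Q) (hq : q ∈ Q)
    (h : p ≤ q) : zcomp Q p = zcomp Q q :=
  zcomp_eq (.single ⟨hp, hq, .inl h⟩)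

theorem zcomp_isInterval {P : Type} [Preorder P] {Q : Set P} (hQ : Q.OrdConnected) {p : P}
    (hp : p ∈ Q) : IsInterval (zcomp Q p) := by
  refine ⟨⟨p, .refl⟩, ⟨?_⟩, ?_⟩
  · intro a ha b hb c hc
    have haQ := zcomp_subset hp ha
    have hbQ := zcomp_subset hp hb
    have hcQ : c ∈ Q := hQ.out haQ hbQ hc
    exact Relation.ReflTransGen.tail ha ⟨haQ, hcQ, .inl hc.1⟩
  · have key : ∀ a, a ∈ zcomp Q p → Relation.ReflTransGen
        (fun a b => a ∈ zcomp Q p ∧ b ∈ zcomp Q p ∧ (a ≤ b ∨ b ≤ a)) p a := by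
      intro a ha
      induction ha with
      | refl => exact .refl
      | tail h1 h2 ih => exact ih.tail ⟨h1, h1.tail h2, h2.2.2⟩
    intro a ha b hb
    exact (zrel_symm (key a ha)).trans (key b hb)

/-- The generator of the indicator module at a point of the set. -/
def indOne {P : Type} [Preorder P] (Q : Set P) (hQ : Q.OrdConnected) (t : P) (ht : t ∈ Q) :
    (indicator k Q hQ).obj t :=
  (⟨1, fun h => absurd ht h⟩ : indSub k Q t)

theorem indMap_one {P : Type} [Preorder P] (Q : Set P) (hQ : Q.OrdConnected) {s t : P}
    (f : s ⟶ t) (hs : s ∈ Q) (ht : t ∈ Q) :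
    ((indicator k Q hQ).map f).hom (indOne k Q hQ s hs) = indOne k Q hQ t ht := by
  apply Subtype.ext
  change (if s ∈ Q ∧ t ∈ Q then (1 : k) else 0) = 1
  simp [hs, ht]

theorem ind_zero {P : Type} [Preorder P] (Q : Set P) (hQ : Q.OrdConnected) {t : P} (ht : t ∉ Q)
    (x : (indicator k Q hQ).obj t) : x = 0 :=
  Subtype.ext (x.2 ht)

theorem ind_smul {P : Type} [Preorder P] (Q : Set P) (hQ : Q.OrdConnected) {t : P} (ht : t ∈ Q)
    (x : (indicator k Q hQ).obj t) : ∃ c : k, x = c • indOne k Q hQ t ht := by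
  refine ⟨(x : indSub k Q t).1, Subtype.ext ?_⟩
  change (x : indSub k Q t).1 = (x : indSub k Q t).1 * 1
  simp

/-- Morphism out of an indicator module. -/
def indDesc {P : Type} [Preorder P] (Q : Set P) (hQ : Q.OrdConnected) (N : PersistenceModule k P)
    (v : ∀ t, N.obj t)
    (h1 : ∀ s t (f : s ⟶ t), s ∈ Q → t ∈ Q → (N.map f).hom (v s) = v t)
    (h0 : ∀ s t (f : s ⟶ t), s ∈ Q → t ∉ Q → (N.map f).hom (v s) = 0) :
    indicator k Q hQ ⟶ N where
  app t := ModuleCat.ofHom ((LinearMap.toSpanSingleton k (N.obj t) (v t)).comp (indSub k Q t).subtype)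
  naturality s t f := by
    refine ModuleCat.hom_ext <| LinearMap.ext fun x => ?_
    change indSub k Q s at x
    change (indMap k Q s t x : k) • v t = (N.map f).hom ((x : k) • v s)
    rw [indMap_coe, map_smul]
    by_cases hs : s ∈ Q
    · by_cases ht : t ∈ Q
      · simp [hs, ht, h1 s t f hs ht]
      · simp [ht, h0 s t f hs ht]
    · have : (x : k) = 0 := x.2 hs
      simp [this]

theorem indDesc_one {P : Type} [Preorder P] (Q : Set P) (hQ : Q.OrdConnected)
    (N : PersistenceModule k P) (v : ∀ t, N.obj t) (h1) (h0) (t : P) (ht : t ∈ Q) :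
    ((indDesc k Q hQ N v h1 h0).app t).hom (indOne k Q hQ t ht) = v t := by
  change (1 : k) • v t = v t
  simp

theorem ind_hom_ext {P : Type} [Preorder P] {Q : Set P} {hQ : Q.OrdConnected}
    {N : PersistenceModule k P} {f g : indicator k Q hQ ⟶ N}
    (h : ∀ t (ht : t ∈ Q), (f.app t).hom (indOne k Q hQ t ht) = (g.app t).hom (indOne k Q hQ t ht)) :
    f = g := by
  refine NatTrans.ext (funext fun t => ModuleCat.hom_ext <| LinearMap.ext fun x => ?_)
  by_cases ht : t ∈ Q
  · obtain ⟨c, rfl⟩ := ind_smul k Q hQ ht x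
    rw [map_smul, map_smul, h t ht]
  · rw [ind_zero k Q hQ ht x, map_zero, map_zero]

theorem decomp_of_basis {P : Type} [Preorder P] (N : PersistenceModule k P) {ι : Type}
    (Q : ι → Set P) (hQ : ∀ i, (Q i).OrdConnected)
    (v : ι → ∀ t, N.obj t)
    (b : ∀ t, Module.Basis {i // t ∈ Q i} k (N.obj t))
    (hb : ∀ t i, b t i = v i.1 t)
    (h1 : ∀ i s t (f : s ⟶ t), s ∈ Q i → t ∈ Q i → (N.map f).hom (v i s) = v i t)
    (h0 : ∀ i s t (f : s ⟶ t), s ∈ Q i → t ∉ Q i → (N.map f).hom (v i s) = 0) :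
    IntervalDecomposable k N := by
  let J : Type := {j : ι × Set P // ∃ p ∈ Q j.1, j.2 = zcomp (Q j.1) p}
  have hI : ∀ j : J, IsInterval j.1.2 := by
    rintro ⟨⟨i, C⟩, p, hp, hC⟩
    dsimp only at hp hC
    subst hC
    exact zcomp_isInterval (hQ i) hp
  have hsub : ∀ j : J, j.1.2 ⊆ Q j.1.1 := by
    rintro ⟨⟨i, C⟩, p, hp, hC⟩
    dsimp only at hp hC
    subst hC
    exact zcomp_subset hp
  have hclosed : ∀ (j : J) (s t : P), s ≤ t → s ∈ j.1.2 → t ∈ Q j.1.1 → t ∈ j.1.2 := by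
    rintro ⟨⟨i, C⟩, p, hp, hC⟩ s t hst hs ht
    dsimp only at hp hC hs ht
    subst hC
    exact Relation.ReflTransGen.tail hs ⟨zcomp_subset hp hs, ht, .inl hst⟩
  let mk : ∀ (t : P) (i : {i // t ∈ Q i}), J := fun t i => ⟨(i.1, zcomp (Q i.1) t), t, i.2, rfl⟩
  have hmkmem : ∀ t i, t ∈ (mk t i).1.2 := fun t i => Relation.ReflTransGen.refl
  have hmk : ∀ (j : J) (t : P) (ht : t ∈ j.1.2), mk t ⟨j.1.1, hsub j ht⟩ = j := by
    rintro ⟨⟨i, C⟩, p, hp, hC⟩ t ht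
    dsimp only at hp hC ht
    subst hC
    apply Subtype.ext
    exact Prod.ext rfl (zcomp_eq ht).symm
  let inj : ∀ j : J, indicator k j.1.2 (hI j).2.1 ⟶ N := fun j =>
    indDesc k j.1.2 (hI j).2.1 N (v j.1.1)
      (fun s t f hs ht => h1 _ s t f (hsub j hs) (hsub j ht))
      (fun s t f hs ht => h0 _ s t f (hsub j hs) (fun h => ht (hclosed j s t f.le hs h)))
  have hinj : ∀ j t (ht : t ∈ j.1.2),
      ((inj j).app t).hom (indOne k _ (hI j).2.1 t ht) = v j.1.1 t := fun j t ht =>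
    indDesc_one k _ _ _ _ _ _ t ht
  have hone : ∀ {Z : PersistenceModule k P} (g : ∀ j : J, indicator k j.1.2 (hI j).2.1 ⟶ Z)
      (j j' : J) (_ : j = j') (t : P) (ht : t ∈ j.1.2) (ht' : t ∈ j'.1.2),
      ((g j).app t).hom (indOne k _ (hI j).2.1 t ht) =
      ((g j').app t).hom (indOne k _ (hI j').2.1 t ht') := by
    rintro Z g j _ rfl t ht ht'
    rfl
  let desc : ∀ (Z : PersistenceModule k P) (g : ∀ j : J, indicator k j.1.2 (hI j).2.1 ⟶ Z), N ⟶ Z :=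
    fun Z g =>
    { app := fun t => ModuleCat.ofHom ((b t).constr k fun i =>
        ((g (mk t i)).app t).hom (indOne k _ (hI _).2.1 t (hmkmem t i)))
      naturality := by
        intro s t f
        refine ModuleCat.hom_ext ((b s).ext fun i => ?_)
        change (b t).constr k _ ((N.map f).hom (b s i)) = (Z.map f).hom ((b s).constr k _ (b s i))
        rw [Module.Basis.constr_basis, hb s i]
        have hnat : (Z.map f).hom (((g (mk s i)).app s).hom (indOne k _ (hI _).2.1 s (hmkmem s i)))
          = ((g (mk s i)).app t).hom (((indicator k _ (hI (mk s i)).2.1).map f).hom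
              (indOne k _ (hI _).2.1 s (hmkmem s i))) := by
          have := (g (mk s i)).naturality f
          exact (LinearMap.congr_fun (congrArg ModuleCat.Hom.hom this)
            (indOne k _ (hI _).2.1 s (hmkmem s i))).symm
        rw [hnat]
        by_cases ht : t ∈ Q i.1
        · have ht' : t ∈ (mk s i).1.2 := hclosed (mk s i) s t f.le (hmkmem s i) ht
          rw [indMap_one k _ _ f (hmkmem s i) ht', h1 _ s t f i.2 ht]
          have := hb t ⟨i.1, ht⟩
          dsimp only at this
          rw [← this, Module.Basis.constr_basis]
          exact hone g _ _ (hmk (mk s i) t ht') t _ _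
        · have ht' : t ∉ (mk s i).1.2 := fun h => ht (hsub (mk s i) h)
          rw [h0 _ s t f i.2 ht, map_zero]
          have hz := ind_zero k _ (hI (mk s i)).2.1 ht'
            (((indicator k _ (hI (mk s i)).2.1).map f).hom
              (indOne k _ (hI _).2.1 s (hmkmem s i)))
          exact ((congrArg ((g (mk s i)).app t).hom hz).trans (map_zero _)).symm }
  have hdesc : ∀ Z g t i, ((desc Z g).app t).hom (b t i) =
      ((g (mk t i)).app t).hom (indOne k _ (hI _).2.1 t (hmkmem t i)) := by
    intro Z g t i
    change (b t).constr k _ (b t i) = _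
    rw [Module.Basis.constr_basis]
  let c : Cofan (fun j : J => indicator k j.1.2 (hI j).2.1) := Cofan.mk N inj
  have hc : IsColimit c := by
    refine Cofan.IsColimit.mk c (fun s => desc s.pt s.inj) ?_ ?_
    · intro s j
      refine ind_hom_ext k fun t ht => ?_
      change ((desc s.pt s.inj).app t).hom (((inj j).app t).hom _) = _
      rw [hinj]
      have := hb t ⟨j.1.1, hsub j ht⟩
      dsimp only at this
      rw [← this, hdesc]
      exact hone s.inj _ _ (hmk j t ht) t _ _
    · intro s m hm
      refine NatTrans.ext (funext fun t => ModuleCat.hom_ext ((b t).ext fun i => ?_))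
      rw [hdesc, hb, ← hm (mk t i)]
      change _ = (m.app t).hom (((inj (mk t i)).app t).hom _)
      rw [hinj]
  exact ⟨J, fun j => j.1.2, hI, ⟨hc.coconePointUniqueUpToIso (colimit.isColimit _)⟩⟩

/-- The submodules `S`. -/
def SS (n : ℕ) (p : ℕ × ℕ) : Submodule k (k × k) where
  carrier := {w | (p.1 + p.2 < n - 1 → w.1 = 0 ∧ w.2 = 0) ∧
    (p.1 = 0 ∧ p.2 = n - 1 → w.2 = 0) ∧ (p.1 = n - 1 ∧ p.2 = 0 → w.1 = w.2)}
  add_mem' := by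
    rintro a b ⟨h1, h2, h3⟩ ⟨h1', h2', h3'⟩
    refine ⟨fun h => ?_, fun h => ?_, fun h => ?_⟩
    · simp [h1 h, h1' h]
    · simp [h2 h, h2' h]
    · simp [h3 h, h3' h]
  zero_mem' := by simp
  smul_mem' := by
    rintro c a ⟨h1, h2, h3⟩
    refine ⟨fun h => ?_, fun h => ?_, fun h => ?_⟩
    · simp [h1 h]
    · simp [h2 h]
    · simp [h3 h]

/-- The submodules `T`. -/
def TT (n : ℕ) (p : ℕ × ℕ) : Submodule k (k × k) where
  carrier := {w | (p.1 + p.2 ≤ n → w.1 = 0 ∧ w.2 = 0) ∧ (p.1 = 2 ∧ p.2 = n - 1 → w.1 = 0)}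
  add_mem' := by
    rintro a b ⟨h1, h2⟩ ⟨h1', h2'⟩
    refine ⟨fun h => ?_, fun h => ?_⟩
    · simp [h1 h, h1' h]
    · simp [h2 h, h2' h]
  zero_mem' := by simp
  smul_mem' := by
    rintro c a ⟨h1, h2⟩
    refine ⟨fun h => ?_, fun h => ?_⟩
    · simp [h1 h]
    · simp [h2 h]

theorem mem_SS {n : ℕ} {p : ℕ × ℕ} {w : k × k} : w ∈ SS k n p ↔
    (p.1 + p.2 < n - 1 → w.1 = 0 ∧ w.2 = 0) ∧
    (p.1 = 0 ∧ p.2 = n - 1 → w.2 = 0) ∧ (p.1 = n - 1 ∧ p.2 = 0 → w.1 = w.2) := Iff.rfl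

theorem mem_TT {n : ℕ} {p : ℕ × ℕ} {w : k × k} : w ∈ TT k n p ↔
    (p.1 + p.2 ≤ n → w.1 = 0 ∧ w.2 = 0) ∧ (p.1 = 2 ∧ p.2 = n - 1 → w.1 = 0) := Iff.rfl

theorem SS_mono (n : ℕ) : Monotone (SS k n) := by
  rintro ⟨a, b⟩ ⟨c, d⟩ ⟨h1, h2⟩ w hw
  rw [mem_SS] at hw ⊢
  dsimp only at *
  obtain ⟨ha, hb, hc⟩ := hw
  refine ⟨fun h => ha (by omega), fun h => ?_, fun h => ?_⟩
  · by_cases h' : a + b < n - 1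
    · exact (ha h').2
    · exact hb (by omega)
  · by_cases h' : a + b < n - 1
    · rw [(ha h').1, (ha h').2]
    · exact hc (by omega)

theorem TT_mono (n : ℕ) (hn : 3 ≤ n) : Monotone (TT k n) := by
  rintro ⟨a, b⟩ ⟨c, d⟩ ⟨h1, h2⟩ w hw
  rw [mem_TT] at hw ⊢
  dsimp only at *
  obtain ⟨ha, hb⟩ := hw
  refine ⟨fun h => ha (by omega), fun h => ?_⟩
  by_cases h' : a + b ≤ n
  · exact (ha h').1
  · exact hb (by omega)

/-- The module `S/T`. -/
def SQ {R : Type} [Preorder R] (n : ℕ) (hn : 3 ≤ n) (g : R → ℕ × ℕ) (hg : Monotone g) :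
    PersistenceModule k R where
  obj t := ModuleCat.of k (SS k n (g t) ⧸ (TT k n (g t)).submoduleOf (SS k n (g t)))
  map {s t} f := ModuleCat.ofHom (Submodule.mapQ _ _
    (Submodule.inclusion (SS_mono k n (hg f.le))) (fun _ hx => TT_mono k n hn (hg f.le) hx))
  map_id t := by
    refine ModuleCat.hom_ext <| LinearMap.ext fun x => ?_
    obtain ⟨x, rfl⟩ := Submodule.Quotient.mk_surjective _ x
    rfl
  map_comp f h := by
    refine ModuleCat.hom_ext <| LinearMap.ext fun x => ?_
    obtain ⟨x, rfl⟩ := Submodule.Quotient.mk_surjective _ x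
    rfl

section SQ

variable {R : Type} [Preorder R] {n : ℕ} {hn : 3 ≤ n} {g : R → ℕ × ℕ} {hg : Monotone g}

variable (hn hg) in
/-- class of a vector. -/
def clq (t : R) : SS k n (g t) →ₗ[k] (SQ k n hn g hg).obj t :=
  ((TT k n (g t)).submoduleOf (SS k n (g t))).mkQ

variable (hn hg) in
/-- class of a vector (junk zero outside `S`). -/
def cl (t : R) (w : k × k) : (SQ k n hn g hg).obj t :=
  if h : w ∈ SS k n (g t) then clq k hn hg t ⟨w, h⟩ else 0

theorem cl_pos (t : R) {w : k × k} (h : w ∈ SS k n (g t)) :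
    cl k hn hg t w = clq k hn hg t ⟨w, h⟩ := dif_pos h

theorem cl_surj (t : R) (m : (SQ k n hn g hg).obj t) :
    ∃ w ∈ SS k n (g t), m = cl k hn hg t w := by
  obtain ⟨x, rfl⟩ := Submodule.Quotient.mk_surjective _ m
  refine ⟨x.1, x.2, ?_⟩
  exact (cl_pos k t x.2).symm

theorem cl_add (t : R) {w w' : k × k} (h : w ∈ SS k n (g t)) (h' : w' ∈ SS k n (g t)) :
    cl k hn hg t (w + w') = cl k hn hg t w + cl k hn hg t w' := by
  rw [cl_pos k t h, cl_pos k t h', cl_pos k t (add_mem h h'), ← map_add]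
  rfl

theorem cl_smul (t : R) (c : k) {w : k × k} (h : w ∈ SS k n (g t)) :
    cl k hn hg t (c • w) = c • cl k hn hg t w := by
  rw [cl_pos k t h, cl_pos k t (Submodule.smul_mem _ c h), ← map_smul]
  rfl

theorem cl_zero (t : R) : cl k hn hg t 0 = 0 := by
  rw [cl_pos k t (zero_mem _)]
  exact map_zero _

theorem cl_lin (t : R) {w w' : k × k} {a b : k} (h : a = 0 ∨ w ∈ SS k n (g t))
    (h' : b = 0 ∨ w' ∈ SS k n (g t)) :
    a • w + b • w' ∈ SS k n (g t) ∧
    cl k hn hg t (a • w + b • w') = a • cl k hn hg t w + b • cl k hn hg t w' := by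
  have key : ∀ (a : k) (w : k × k), (a = 0 ∨ w ∈ SS k n (g t)) →
      a • w ∈ SS k n (g t) ∧ cl k hn hg t (a • w) = a • cl k hn hg t w := by
    rintro a w (rfl | h)
    · rw [zero_smul, zero_smul]
      exact ⟨zero_mem _, cl_zero k t⟩
    · exact ⟨Submodule.smul_mem _ _ h, cl_smul k t a h⟩
  obtain ⟨h1, h2⟩ := key a w h
  obtain ⟨h3, h4⟩ := key b w' h'
  exact ⟨add_mem h1 h3, by rw [cl_add k t h1 h3, h2, h4]⟩

theorem cl_eq_zero (t : R) {w : k × k} (h : w ∈ SS k n (g t)) :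
    cl k hn hg t w = 0 ↔ w ∈ TT k n (g t) := by
  rw [cl_pos k t h]
  exact Submodule.Quotient.mk_eq_zero _

theorem cl_eq (t : R) {w w' : k × k} (h : w ∈ SS k n (g t)) (h' : w' ∈ SS k n (g t)) :
    cl k hn hg t w = cl k hn hg t w' ↔ w - w' ∈ TT k n (g t) := by
  rw [cl_pos k t h, cl_pos k t h']
  exact Submodule.Quotient.eq _

theorem cl_map {s t : R} (f : s ⟶ t) {w : k × k} (h : w ∈ SS k n (g s)) :
    ((SQ k n hn g hg).map f).hom (cl k hn hg s w) = cl k hn hg t w := by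
  rw [cl_pos k s h, cl_pos k t (SS_mono k n (hg f.le) h)]
  rfl

theorem bool_li {W : Type} [AddCommGroup W] [Module k W] (q : Bool → Prop) (v : Bool → W)
    (h : ∀ a b : k, (¬ q true → a = 0) → (¬ q false → b = 0) → a • v true + b • v false = 0 →
      a = 0 ∧ b = 0) : LinearIndependent k (fun i : {i // q i} => v i.1) := by
  rw [Fintype.linearIndependent_iff]
  intro c hc
  let d : Bool → k := fun i => if h : q i then c ⟨i, h⟩ else 0
  have hd : ∀ i : {i // q i}, c i = d i.1 := fun i => by simp [d, i.2]
  have hsum : ∑ i : Bool, d i • v i = 0 := by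
    rw [← hc]
    simp only [hd]
    symm
    calc ∑ i : {i // q i}, d i.1 • v i.1 = ∑ i ∈ Finset.univ.filter q, d i • v i :=
          (Finset.sum_subtype (Finset.univ.filter q) (by simp) (fun i => d i • v i)).symm
      _ = ∑ i : Bool, d i • v i := by
          refine Finset.sum_filter_of_ne fun i _ hi => ?_
          by_contra hq
          exact hi (by simp [d, hq])
  rw [Fintype.sum_bool] at hsum
  obtain ⟨h1, h2⟩ := h _ _ (fun h => by simp [d, h]) (fun h => by simp [d, h]) hsum
  rintro ⟨_ | _, hi⟩
  · rw [hd]; exact h2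
  · rw [hd]; exact h1

theorem bool_span {W : Type} [AddCommGroup W] [Module k W] (q : Bool → Prop) (v : Bool → W)
    (h : ∀ m, ∃ a b : k, (¬ q true → a = 0) ∧ (¬ q false → b = 0) ∧
      m = a • v true + b • v false) :
    ⊤ ≤ Submodule.span k (Set.range (fun i : {i // q i} => v i.1)) := by
  intro m _
  obtain ⟨a, b, ha, hb, rfl⟩ := h m
  have key : ∀ i (a : k), (¬ q i → a = 0) →
      a • v i ∈ Submodule.span k (Set.range (fun i : {i // q i} => v i.1)) := by
    intro i a ha
    by_cases hi : q i
    · exact Submodule.smul_mem _ _ (Submodule.subset_span ⟨⟨i, hi⟩, rfl⟩)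
    · rw [ha hi, zero_smul]; exact zero_mem _
  exact add_mem (key _ _ ha) (key _ _ hb)

/-- first support -/
def Q1 (n : ℕ) : Set (ℕ × ℕ) := {p | n - 1 ≤ p.1 + p.2 ∧ (p.1 + p.2 ≤ n ∨ (p.1 = 2 ∧ p.2 = n - 1))}

/-- second support -/
def Q2 (n : ℕ) : Set (ℕ × ℕ) := {p | n - 1 ≤ p.1 + p.2 ∧ p.1 + p.2 ≤ n ∧
  ¬ (p.1 = 0 ∧ p.2 = n - 1) ∧ ¬ (p.1 = n - 1 ∧ p.2 = 0)}

theorem SQ_decomp (σ : R → Prop)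
    (hσ1 : ∀ t, (g t).1 = 0 ∧ (g t).2 = n - 1 → σ t)
    (hσ2 : ∀ t, (g t).1 = n - 1 ∧ (g t).2 = 0 → ¬ σ t)
    (hσ : ∀ s t, s ≤ t → n - 1 ≤ (g s).1 + (g s).2 → ¬ (σ s ↔ σ t) → n + 1 ≤ (g t).1 + (g t).2) :
    IntervalDecomposable k (SQ k n hn g hg) := by
  let Q : Bool → Set R := fun i => if i then g ⁻¹' Q1 n else g ⁻¹' Q2 n
  let u : R → k × k := fun t => if σ t then (1, 0) else (1, 1)
  have hu1 : ∀ t, g t ∈ Q1 n → u t ∈ SS k n (g t) := by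
    intro t ht
    rw [mem_SS]
    refine ⟨fun h => ?_, fun h => ?_, fun h => ?_⟩
    · have := ht.1; omega
    · simp [u, hσ1 t h]
    · simp [u, hσ2 t h]
  have hu2 : ∀ t, g t ∈ Q2 n → ((0, 1) : k × k) ∈ SS k n (g t) := by
    intro t ht
    rw [mem_SS]
    refine ⟨fun h => ?_, fun h => ?_, fun h => ?_⟩
    · have := ht.1; omega
    · exact absurd h ht.2.2.1
    · exact absurd h ht.2.2.2
  let v : Bool → ∀ t, (SQ k n hn g hg).obj t := fun i t =>
    if i then cl k hn hg t (u t) else cl k hn hg t (0, 1)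
  have hli : ∀ t, LinearIndependent k (fun i : {i // t ∈ Q i} => v i.1 t) := by
    intro t
    refine bool_li k (fun i => t ∈ Q i) (fun i => v i t) ?_
    intro a b ha hb hab
    change ¬ (g t ∈ Q1 n) → a = 0 at ha
    change ¬ (g t ∈ Q2 n) → b = 0 at hb
    change a • cl k hn hg t (u t) + b • cl k hn hg t (0, 1) = 0 at hab
    obtain ⟨hm, he⟩ := cl_lin k (hn := hn) (hg := hg) t (w := u t) (w' := (0, 1)) (a := a) (b := b)
      (or_iff_not_imp_right.2 fun h => ha fun h' => h (hu1 t h'))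
      (or_iff_not_imp_right.2 fun h => hb fun h' => h (hu2 t h'))
    rw [← he, cl_eq_zero k t hm, mem_TT] at hab
    have e1 : (a • u t + b • ((0, 1) : k × k)).1 = a := by
      simp only [u]; split_ifs <;> simp
    have e2 : a = 0 → (a • u t + b • ((0, 1) : k × k)).2 = b := by
      rintro rfl; simp
    rw [e1] at hab
    by_cases h1 : g t ∈ Q1 n
    · rcases h1.2 with h | h
      · obtain ⟨h2, h3⟩ := hab.1 h
        exact ⟨h2, by rw [← e2 h2, h3]⟩
      · refine ⟨hab.2 h, hb fun h2 => ?_⟩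
        have := h2.2.1
        omega
    · refine ⟨ha h1, hb fun h2 => h1 ⟨h2.1, .inl h2.2.1⟩⟩
  have hsp : ∀ t, ⊤ ≤ Submodule.span k (Set.range (fun i : {i // t ∈ Q i} => v i.1 t)) := by
    intro t
    refine bool_span k (fun i => t ∈ Q i) (fun i => v i t) ?_
    intro m
    obtain ⟨w, hw, rfl⟩ := cl_surj k t m
    change ∃ a b : k, (¬ (g t ∈ Q1 n) → a = 0) ∧ (¬ (g t ∈ Q2 n) → b = 0) ∧
      cl k hn hg t w = a • cl k hn hg t (u t) + b • cl k hn hg t (0, 1)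
    by_cases h1 : g t ∈ Q1 n
    · by_cases h2 : g t ∈ Q2 n
      · refine ⟨w.1, w.2 - w.1 * (u t).2, fun h => absurd h1 h, fun h => absurd h2 h, ?_⟩
        rw [← (cl_lin k t (.inr (hu1 t h1)) (.inr (hu2 t h2))).2]
        congr 1
        have : (u t).1 = 1 := by simp only [u]; split_ifs <;> rfl
        ext <;> simp [this]
      · refine ⟨w.1, 0, fun h => absurd h1 h, fun _ => rfl, ?_⟩
        obtain ⟨hm, he⟩ := cl_lin k (hn := hn) (hg := hg) t (w := u t) (w' := (0, 1))
          (a := w.1) (b := 0) (.inr (hu1 t h1)) (.inl rfl)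
        rw [← he, cl_eq k t hw hm, mem_TT]
        have e1 : (u t).1 = 1 := by simp only [u]; split_ifs <;> rfl
        refine ⟨fun h => ?_, fun _ => by simp [e1]⟩
        have h3 := h1.1
        by_cases hc : (g t).1 = 0 ∧ (g t).2 = n - 1
        · have := hw.2.1 hc
          simp [u, hσ1 t hc, this]
        · by_cases hc' : (g t).1 = n - 1 ∧ (g t).2 = 0
          · have := hw.2.2 hc'
            simp [u, hσ2 t hc', this]
          · exact absurd ⟨h3, h, hc, hc'⟩ h2
    · refine ⟨0, 0, fun _ => rfl, fun _ => rfl, ?_⟩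
      rw [zero_smul, zero_smul, add_zero, cl_eq_zero k t hw, mem_TT]
      have h3 : ¬ (n - 1 ≤ (g t).1 + (g t).2 ∧
        ((g t).1 + (g t).2 ≤ n ∨ ((g t).1 = 2 ∧ (g t).2 = n - 1))) := h1
      exact ⟨fun h => hw.1 (by omega), fun h => by omega⟩
  refine decomp_of_basis k _ Q ?_ v (fun t => Module.Basis.mk (hli t) (hsp t)) ?_ ?_ ?_
  · rintro (_ | _)
    · refine ⟨fun a ha b hb c hc => ?_⟩
      have h1 := hg hc.1
      have h2 := hg hc.2
      simp only [Q, Q2, Bool.false_eq_true, if_false, Set.mem_preimage, Set.mem_ofPred_eq, Prod.le_def] at *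
      omega
    · refine ⟨fun a ha b hb c hc => ?_⟩
      have h1 := hg hc.1
      have h2 := hg hc.2
      simp only [Q, Q1, if_true, Set.mem_preimage, Set.mem_ofPred_eq, Prod.le_def] at *
      omega
  · intro t i
    rw [Module.Basis.mk_apply]
  · rintro (_ | _) s t f hs ht
    · exact cl_map k f (hu2 s hs)
    · change ((SQ k n hn g hg).map f).hom (cl k hn hg s (u s)) = cl k hn hg t (u t)
      rw [cl_map k f (hu1 s hs), cl_eq k t (SS_mono k n (hg f.le) (hu1 s hs)) (hu1 t ht)]
      by_cases hst : σ s ↔ σ t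
      · have : u s = u t := by simp [u, hst]
        rw [this, sub_self]; exact zero_mem _
      · have h3 := hσ s t f.le hs.1 hst
        rw [mem_TT]
        refine ⟨fun h => by omega, fun h => ?_⟩
        simp only [u]
        split_ifs <;> simp
  · rintro (_ | _) s t f hs ht
    · change ((SQ k n hn g hg).map f).hom (cl k hn hg s (0, 1)) = 0
      rw [cl_map k f (hu2 s hs), cl_eq_zero k t (SS_mono k n (hg f.le) (hu2 s hs)), mem_TT]
      refine ⟨fun h => ?_, fun h => rfl⟩
      exfalso
      apply ht
      have h1 := hg f.le
      simp only [Q, Q2, Bool.false_eq_true, if_false, Set.mem_preimage, Set.mem_ofPred_eq, Prod.le_def] at *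
      omega
    · change ((SQ k n hn g hg).map f).hom (cl k hn hg s (u s)) = 0
      rw [cl_map k f (hu1 s hs), cl_eq_zero k t (SS_mono k n (hg f.le) (hu1 s hs)), mem_TT]
      have h1 := hg f.le
      simp only [Q, Q1, if_true, Set.mem_preimage, Set.mem_ofPred_eq, Prod.le_def] at *
      exact ⟨fun h => by omega, fun h => by omega⟩

theorem SQ_endo (φ : SQ k n hn g hg ⟶ SQ k n hn g hg)
    (h : ℕ × ℕ → R) (hh : Monotone h)
    (hgh : ∀ i j, i ≤ n - 1 → j ≤ n - 1 → g (h (i, j)) = (i, j)) :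
    ∃ c : k, ∀ m, (φ.app (h (1, n - 1))).hom m = c • m := by
  let Rl : R → k × k → k × k → Prop := fun t v w =>
    (φ.app t).hom (cl k hn hg t v) = cl k hn hg t w
  have ex : ∀ t v, ∃ w ∈ SS k n (g t), Rl t v w := fun t v => cl_surj k t _
  have up : ∀ s t v w, s ≤ t → v ∈ SS k n (g s) → w ∈ SS k n (g s) → Rl s v w → Rl t v w := by
    intro s t v w hst hv hw hr
    have h1 := φ.naturality (homOfLE hst)
    have h2 := LinearMap.congr_fun (congrArg ModuleCat.Hom.hom h1) (cl k hn hg s v)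
    change (φ.app t).hom (((SQ k n hn g hg).map (homOfLE hst)).hom (cl k hn hg s v)) =
      ((SQ k n hn g hg).map (homOfLE hst)).hom ((φ.app s).hom (cl k hn hg s v)) at h2
    have hr' : (φ.app s).hom (cl k hn hg s v) = cl k hn hg s w := hr
    rw [hr', cl_map k _ hv, cl_map k _ hw] at h2
    exact h2
  let full : R → Prop := fun t => (∀ w, w ∈ SS k n (g t)) ∧ (∀ w, w ∈ TT k n (g t) → w = 0)
  have uniq : ∀ t v w w', full t → Rl t v w → Rl t v w' → w = w' := by
    intro t v w w' ht h1 h2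
    have h3 : cl k hn hg t w = cl k hn hg t w' := h1.symm.trans h2
    rw [cl_eq k t (ht.1 _) (ht.1 _)] at h3
    exact sub_eq_zero.1 (ht.2 _ h3)
  have down : ∀ s t v w, s ≤ t → full s → full t → Rl t v w → Rl s v w := by
    intro s t v w hst hs ht hr
    obtain ⟨w', hw', hr'⟩ := ex s v
    have := uniq t v w w' ht hr (up s t v w' hst (hs.1 _) hw' hr')
    rw [this]; exact hr'
  have hfull : ∀ i j, i ≤ n - 1 → j ≤ n - 1 → n - 1 ≤ i + j → i + j ≤ n → 1 ≤ i → 1 ≤ j →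
      full (h (i, j)) := by
    intro i j hi hj h1 h2 h3 h4
    refine ⟨fun w => ?_, fun w hw => ?_⟩
    · rw [mem_SS, hgh i j hi hj]
      exact ⟨fun h => by dsimp only at h; omega, fun h => by dsimp only at h; omega,
        fun h => by dsimp only at h; omega⟩
    · rw [mem_TT, hgh i j hi hj] at hw
      obtain ⟨h5, h6⟩ := hw.1 h2
      exact Prod.ext h5 h6
  have hle : ∀ i j i' j', i ≤ i' → j ≤ j' → h (i, j) ≤ h (i', j') := by
    intro i j i' j' h1 h2
    exact hh ⟨h1, h2⟩
  have chain : ∀ i, i + 2 ≤ n → ∀ v w, Rl (h (1, n - 1)) v w → Rl (h (i + 1, n - 1 - i)) v w := by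
    intro i
    induction i with
    | zero => intro _ v w hr; exact hr
    | succ i ih =>
      intro hi v w hr
      have h1 := ih (by omega) v w hr
      have f1 := hfull (i + 1) (n - 1 - i) (by omega) (by omega) (by omega) (by omega) (by omega) (by omega)
      have f2 := hfull (i + 1) (n - 1 - (i + 1)) (by omega) (by omega) (by omega) (by omega) (by omega) (by omega)
      have h2 := down (h (i + 1, n - 1 - (i + 1))) _ v w
        (hle _ _ _ _ (le_refl _) (by omega)) f2 f1 h1
      exact up _ (h (i + 1 + 1, n - 1 - (i + 1))) v w (hle _ _ _ _ (by omega) (le_refl _))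
        (f2.1 _) (f2.1 _) h2
  have fa := hfull 1 (n - 1) (by omega) (by omega) (by omega) (by omega) (by omega) (by omega)
  have fb := hfull (n - 1) 1 (by omega) (by omega) (by omega) (by omega) (by omega) (by omega)
  -- first line
  obtain ⟨w1, hw1, hr1⟩ : ∃ w : k × k, w.2 = 0 ∧ Rl (h (1, n - 1)) (1, 0) w := by
    obtain ⟨w, hw, hr⟩ := ex (h (0, n - 1)) (1, 0)
    have hv : ((1, 0) : k × k) ∈ SS k n (g (h (0, n - 1))) := by
      rw [mem_SS, hgh _ _ (by omega) (by omega)]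
      exact ⟨fun h => by dsimp only at h; omega, fun _ => rfl, fun h => by dsimp only at h; omega⟩
    refine ⟨w, ?_, up _ _ _ _ (hle _ _ _ _ (Nat.zero_le _) (le_refl _)) hv hw hr⟩
    rw [mem_SS, hgh _ _ (by omega) (by omega)] at hw
    exact hw.2.1 ⟨rfl, rfl⟩
  obtain ⟨w3, hw3, hr3⟩ : ∃ w : k × k, w.1 = w.2 ∧ Rl (h (n - 1, 1)) (1, 1) w := by
    obtain ⟨w, hw, hr⟩ := ex (h (n - 1, 0)) (1, 1)
    have hv : ((1, 1) : k × k) ∈ SS k n (g (h (n - 1, 0))) := by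
      rw [mem_SS, hgh _ _ (by omega) (by omega)]
      exact ⟨fun h => by dsimp only at h; omega, fun h => by dsimp only at h; omega, fun _ => rfl⟩
    refine ⟨w, ?_, up _ _ _ _ (hle _ _ _ _ (le_refl _) (Nat.zero_le _)) hv hw hr⟩
    rw [mem_SS, hgh _ _ (by omega) (by omega)] at hw
    exact hw.2.2 ⟨rfl, rfl⟩
  obtain ⟨w2, hw2, hr2⟩ : ∃ w : k × k, w.1 = 0 ∧ Rl (h (1, n - 1)) (0, 1) w := by
    obtain ⟨w, hw, hr⟩ := ex (h (1, n - 1)) (0, 1)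
    refine ⟨w, ?_, hr⟩
    have hq := up _ (h (2, n - 1)) _ _ (hle _ _ _ _ (by omega) (le_refl _)) (fa.1 _) hw hr
    have hS : ∀ w, w ∈ SS k n (g (h (2, n - 1))) := fun w =>
      SS_mono k n (hg (hle _ _ _ _ (by omega) (le_refl _))) (fa.1 w)
    have hz : cl k hn hg (h (2, n - 1)) (0, 1) = 0 := by
      rw [cl_eq_zero k _ (hS _), mem_TT, hgh _ _ (by omega) (by omega)]
      exact ⟨fun h => by dsimp only at h; omega, fun _ => rfl⟩
    have hq' : (φ.app (h (2, n - 1))).hom (cl k hn hg (h (2, n - 1)) (0, 1)) =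
      cl k hn hg (h (2, n - 1)) w := hq
    rw [hz, map_zero] at hq'
    have := (cl_eq_zero k _ (hS _)).1 hq'.symm
    rw [mem_TT, hgh _ _ (by omega) (by omega)] at this
    exact this.2 ⟨rfl, rfl⟩
  have hr12 : Rl (h (1, n - 1)) (1, 1) (w1 + w2) := by
    have e : ((1, 1) : k × k) = (1, 0) + (0, 1) := by simp
    change (φ.app _).hom (cl k hn hg _ _) = cl k hn hg _ _
    rw [e, cl_add k _ (fa.1 _) (fa.1 _), cl_add k _ (fa.1 _) (fa.1 _), map_add]
    exact congrArg₂ (· + ·) hr1 hr2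
  have hc := chain (n - 2) (by omega) _ _ hr12
  rw [show n - 2 + 1 = n - 1 by omega, show n - 1 - (n - 2) = 1 by omega] at hc
  have heq := uniq _ _ _ _ fb hc hr3
  have hcc : w1.1 = w2.2 := by
    have h1 := congrArg Prod.fst heq
    have h2 := congrArg Prod.snd heq
    simp only [Prod.fst_add, Prod.snd_add, hw1, hw2, add_zero, zero_add] at h1 h2
    rw [h1, h2, hw3]
  refine ⟨w1.1, fun m => ?_⟩
  obtain ⟨w, -, rfl⟩ := cl_surj k _ m
  have ew : w = w.1 • ((1, 0) : k × k) + w.2 • ((0, 1) : k × k) := by ext <;> simp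
  have e1 : w1 = w1.1 • ((1, 0) : k × k) := by ext <;> simp [hw1]
  have e2 : w2 = w1.1 • ((0, 1) : k × k) := by ext <;> simp [hw2, hcc]
  have k1 : (φ.app (h (1, n - 1))).hom (cl k hn hg _ (1, 0)) = w1.1 • cl k hn hg _ (1, 0) := by
    rw [← cl_smul k _ _ (fa.1 _), ← e1]; exact hr1
  have k2 : (φ.app (h (1, n - 1))).hom (cl k hn hg _ (0, 1)) = w1.1 • cl k hn hg _ (0, 1) := by
    rw [← cl_smul k _ _ (fa.1 _), ← e2]; exact hr2
  rw [ew, (cl_lin k _ (.inr (fa.1 _)) (.inr (fa.1 _))).2, map_add, map_smul, map_smul, k1, k2,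
    smul_add, smul_comm w1.1, smul_comm w1.1]

theorem SQ_not_decomp (t : R) (ht : g t = (1, n - 1))
    (hsc : ∀ φ : SQ k n hn g hg ⟶ SQ k n hn g hg,
      ∃ c : k, ∀ m, (φ.app t).hom m = c • m) :
    ¬ IntervalDecomposable k (SQ k n hn g hg) := by
  have fS : ∀ w, w ∈ SS k n (g t) := fun w => by
    rw [mem_SS, ht]
    exact ⟨fun h => by dsimp only at h; omega, fun h => by dsimp only at h; omega,
      fun h => by dsimp only at h; omega⟩
  have fT : ∀ w, w ∈ TT k n (g t) → w = 0 := fun w hw => by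
    rw [mem_TT, ht] at hw
    obtain ⟨h5, h6⟩ := hw.1 (by dsimp only; omega)
    exact Prod.ext h5 h6
  rintro ⟨ι, I, hI, ⟨e⟩⟩
  have hzero : ∀ i, (Sigma.ι (fun i => indicator k (I i) (hI i).2.1) i ≫ e.inv).app t = 0 := by
    intro i
    let F := fun i => indicator k (I i) (hI i).2.1
    let α : SQ k n hn g hg ⟶ F i := e.hom ≫ Sigma.π F i
    let β : F i ⟶ SQ k n hn g hg := Sigma.ι F i ≫ e.inv
    have hba : β ≫ α = 𝟙 _ := by simp [α, β]
    obtain ⟨c, hc⟩ := hsc (α ≫ β)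
    have hc' : ∀ m, (β.app t).hom ((α.app t).hom m) = c • m := hc
    have hc0 : c = 0 := by
      obtain ⟨a, b, hab, hne⟩ : ∃ a b : k, a • (α.app t).hom (cl k hn hg t (1, 0)) +
          b • (α.app t).hom (cl k hn hg t (0, 1)) = 0 ∧ ¬ (a = 0 ∧ b = 0) := by
        by_cases hti : t ∈ I i
        · obtain ⟨x, hx⟩ := ind_smul k (I i) (hI i).2.1 hti ((α.app t).hom (cl k hn hg t (1, 0)))
          obtain ⟨y, hy⟩ := ind_smul k (I i) (hI i).2.1 hti ((α.app t).hom (cl k hn hg t (0, 1)))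
          by_cases hx0 : x = 0
          · refine ⟨1, 0, ?_, by simp⟩
            rw [hx, hx0, zero_smul, zero_smul, smul_zero, add_zero]
          · refine ⟨y, -x, ?_, by simp [hx0]⟩
            rw [hx, hy, smul_smul, smul_smul, ← add_smul]
            rw [show y * x + -x * y = 0 by ring, zero_smul]
        · refine ⟨1, 0, ?_, by simp⟩
          rw [zero_smul, add_zero, one_smul]
          exact ind_zero k (I i) (hI i).2.1 hti _
      by_contra hc0
      apply hne
      have h1 := congrArg (β.app t).hom hab
      rw [map_add, map_smul, map_smul, hc', hc', map_zero, smul_comm a, smul_comm b, ← smul_add,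
        ← (cl_lin k _ (.inr (fS _)) (.inr (fS _))).2, smul_eq_zero_iff_right hc0,
        cl_eq_zero k _ (fS _)] at h1
      have h2 := fT _ h1
      have h3 := congrArg Prod.fst h2
      have h4 := congrArg Prod.snd h2
      simp at h3 h4
      exact ⟨h3, h4⟩
    change β.app t = 0
    refine ModuleCat.hom_ext (LinearMap.ext fun x => ?_)
    have h1 : (α.app t).hom ((β.app t).hom x) = x := by
      have := congrArg (fun f => (f.app t).hom x) hba
      exact this
    have h2 := hc' ((β.app t).hom x)
    rw [h1, hc0, zero_smul] at h2
    exact h2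
  have hinv : e.inv.app t = 0 := by
    have hcol := isColimitOfPreserves ((evaluation R (ModuleCat k)).obj t)
      (colimit.isColimit (Discrete.functor (fun i => indicator k (I i) (hI i).2.1)))
    refine hcol.hom_ext ?_
    rintro ⟨i⟩
    rw [comp_zero]
    exact hzero i
  have h1 : cl k hn hg t (1, 0) = 0 := by
    have h2 : e.hom ≫ e.inv = 𝟙 _ := e.hom_inv_id
    have h3 := congrArg (fun f => (f.app t).hom (cl k hn hg t (1, 0))) h2
    change (e.inv.app t).hom ((e.hom.app t).hom _) = cl k hn hg t (1, 0) at h3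
    rw [← h3, hinv]
    rfl
  have h2 := congrArg Prod.fst (fT _ ((cl_eq_zero k _ (fS _)).1 h1))
  simp at h2

end SQ

theorem miss_value (A : Set ℝ) (hA : A.Finite) (n : ℕ) (h : A.ncard < n) (f : A → ℕ) :
    ∃ j, j < n ∧ ∀ x, f x ≠ j := by
  haveI : Fintype A := hA.fintype
  by_contra hcon
  push Not at hcon
  have h1 : Finset.range n ⊆ Finset.univ.image f := by
    intro j hj
    obtain ⟨x, hx⟩ := hcon j (Finset.mem_range.1 hj)
    exact Finset.mem_image.2 ⟨x, Finset.mem_univ _, hx⟩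
  have h2 := (Finset.card_le_card h1).trans Finset.card_image_le
  rw [Finset.card_range, Finset.card_univ, ← Nat.card_eq_fintype_card, Nat.card_coe_set_eq] at h2
  omega

theorem exists_rank (A : Set ℝ) (hA : A.Finite) (n : ℕ) (hn : 3 ≤ n) (h : n ≤ A.ncard) :
    ∃ (f : A → ℕ) (r : ℕ → A), Monotone f ∧ Monotone r ∧ ∀ i, i ≤ n - 1 → f (r i) = i := by
  haveI : Fintype A := hA.fintype
  have hc : Fintype.card A = A.ncard := by
    rw [← Nat.card_eq_fintype_card, Nat.card_coe_set_eq]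
  let e := monoEquivOfFin A hc
  refine ⟨fun x => min (e.symm x).1 (n - 1),
    fun i => e ⟨min i (A.ncard - 1), by omega⟩, ?_, ?_, ?_⟩
  · intro x y hxy
    have : (e.symm x).1 ≤ (e.symm y).1 := e.symm.monotone hxy
    dsimp only
    omega
  · intro i j hij
    refine e.monotone ?_
    change min i _ ≤ min j _
    omega
  · intro i hi
    simp only [OrderIso.symm_apply_apply]
    omega

end Aux


/-- For finite `X, Y ⊆ ℝ` with `|X| ≥ 3` and `|Y| ≥ 3`, there is a pfd
persistence module over `X × Y` that is not interval-decomposable, while its restriction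
to every subgrid `X' × Y'` with `|X'| < min(|X|,|Y|)` or `|Y'| < min(|X|,|Y|)` is
interval-decomposable. -/
theorem exists_not_intervalDecomposable_but_locally_on_subgrids (k : Type) [Field k]
    (X Y : Set ℝ) (hX : X.Finite) (hY : Y.Finite)
    (hX3 : 3 ≤ X.ncard) (hY3 : 3 ≤ Y.ncard) :
    ∃ M : PersistenceModule k (↥X × ↥Y),
      Pfd k M ∧
      ¬ IntervalDecomposable k M ∧
      ∀ (X' Y' : Set ℝ) (hX' : X' ⊆ X) (hY' : Y' ⊆ Y),
        (X'.ncard < min X.ncard Y.ncard ∨ Y'.ncard < min X.ncard Y.ncard) →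
        IntervalDecomposable k
          (restrictAlong k
            (show Monotone (fun p : ↥X' × ↥Y' =>
                ((⟨p.1.1, hX' p.1.2⟩, ⟨p.2.1, hY' p.2.2⟩) : ↥X × ↥Y)) from
              fun _ _ h => ⟨h.1, h.2⟩)
            M) := by
  have hn : 3 ≤ min X.ncard Y.ncard := le_min hX3 hY3
  generalize hnn : min X.ncard Y.ncard = n at hn
  obtain ⟨fX, rX, hfX, hrX, hfrX⟩ := exists_rank X hX n hn (by omega)
  obtain ⟨fY, rY, hfY, hrY, hfrY⟩ := exists_rank Y hY n hn (by omega)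
  have hg : Monotone (fun p : ↥X × ↥Y => ((fX p.1, fY p.2) : ℕ × ℕ)) :=
    fun _ _ h => ⟨hfX h.1, hfY h.2⟩
  refine ⟨SQ k n hn _ hg, ?_, ?_, ?_⟩
  · intro t
    change FiniteDimensional k (SS k n _ ⧸ (TT k n _).submoduleOf (SS k n _))
    infer_instance
  · have hgh : ∀ i j, i ≤ n - 1 → j ≤ n - 1 → (fX (rX i), fY (rY j)) = (i, j) := by
      intro i j hi hj
      rw [hfrX i hi, hfrY j hj]
    refine SQ_not_decomp k (rX 1, rY (n - 1)) (hgh 1 (n - 1) (by omega) (le_refl _)) fun φ => ?_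
    exact SQ_endo k φ (fun p => (rX p.1, rY p.2)) (fun _ _ h => ⟨hrX h.1, hrY h.2⟩) hgh
  · intro X' Y' hX' hY' hlt
    have hg' : Monotone (fun p : ↥X' × ↥Y' =>
        ((fX ⟨p.1.1, hX' p.1.2⟩, fY ⟨p.2.1, hY' p.2.2⟩) : ℕ × ℕ)) :=
      fun _ _ h => ⟨hfX h.1, hfY h.2⟩
    change IntervalDecomposable k (SQ k n hn _ hg')
    rcases hlt with hlt | hlt
    · obtain ⟨j, hj, hmiss⟩ := miss_value X' (hX.subset hX') n hlt (fun x => fX ⟨x.1, hX' x.2⟩)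
      refine SQ_decomp k (fun p => fX ⟨p.1.1, hX' p.1.2⟩ < j) ?_ ?_ ?_
      · intro t h
        have := hmiss t.1
        dsimp only at *
        omega
      · intro t h
        have := hmiss t.1
        dsimp only at *
        omega
      · intro s t hst h1 h2
        have h3 := hmiss t.1
        have h4 := hmiss s.1
        have h5 := (hg' hst).1
        have h6 := (hg' hst).2
        dsimp only at *
        omega
    · obtain ⟨j, hj, hmiss⟩ := miss_value Y' (hY.subset hY') n hlt (fun x => fY ⟨x.1, hY' x.2⟩)
      refine SQ_decomp k (fun p => j < fY ⟨p.2.1, hY' p.2.2⟩) ?_ ?_ ?_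
      · intro t h
        have := hmiss t.2
        dsimp only at *
        omega
      · intro t h
        have := hmiss t.2
        dsimp only at *
        omega
      · intro s t hst h1 h2
        have h3 := hmiss t.2
        have h4 := hmiss s.2
        have h5 := (hg' hst).1
        have h6 := (hg' hst).2
        dsimp only at *
        omega

end PersistencePaper
end
end

section
/- Let A, B, C, D be finite-dimensional k-vector spaces and α : A → B, β : A → C, γ : B → D, δ : C → D linear maps with γ ∘ α = δ ∘ β. Then: (1) for any interval decomposition of the zigzag representation C →δ D ←γ B, the dimension of Im γ ∩ Im δ equals the multiplicity of the full interval (supported on all three vertices) in that decomposition; (2) for any interval decomposition of the zigzag representation C ←β A →α B, the dimension of Ker α + Ker β equals dim A minus the multiplicity of the full interval in that decomposition. -/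
open CategoryTheory Limits Set

noncomputable section

set_option linter.unusedSectionVars false

attribute [local instance] Classical.propDecidable

namespace PersistencePaper

/-- The direct sum of a family of linear maps. -/
def dmap {k : Type} [Field k] {ι : Type} {Mf Nf : ι → Type}
    [∀ i, AddCommGroup (Mf i)] [∀ i, Module k (Mf i)]
    [∀ i, AddCommGroup (Nf i)] [∀ i, Module k (Nf i)]
    (f : ∀ i, Mf i →ₗ[k] Nf i) : DirectSum ι Mf →ₗ[k] DirectSum ι Nf :=
  DirectSum.toModule k ι _ fun i => (DirectSum.lof k ι Nf i).comp (f i)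

/-- The six connected subsets of the vertex set `{0,1,2}` of a three-vertex zigzag
(with middle vertex `1`): the supports of its interval representations. -/
def zigzagIntervals : Set (Set (Fin 3)) :=
  {{0}, {1}, {2}, {0, 1}, {1, 2}, Set.univ}

-- HELP
theorem dmap_apply' {k : Type} [Field k] {ι : Type} {Mf Nf : ι → Type}
    [∀ i, AddCommGroup (Mf i)] [∀ i, Module k (Mf i)]
    [∀ i, AddCommGroup (Nf i)] [∀ i, Module k (Nf i)]
    (f : ∀ i, Mf i →ₗ[k] Nf i) (x : DirectSum ι Mf) (i : ι) :
    dmap f x i = f i (x i) := by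
  have : (DirectSum.component k ι Nf i).comp (dmap f)
      = (f i).comp (DirectSum.component k ι Mf i) := by
    refine DirectSum.linearMap_ext k fun j => LinearMap.ext fun y => ?_
    simp only [LinearMap.comp_apply, dmap, DirectSum.toModule_lof, DirectSum.component.of]
    split_ifs with h
    · subst h; rfl
    · simp
  exact LinearMap.congr_fun this x

theorem univ_of {S : Set (Fin 3)} (h0 : 0 ∈ S) (h1 : 1 ∈ S) (h2 : 2 ∈ S) : S = Set.univ := by
  ext i; fin_cases i <;> simp_all

/-- Projection to the full-interval coordinates. -/
def fproj (k : Type) [Field k] {ι : Type} (S : ι → Set (Fin 3)) :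
    (DirectSum ι fun i => indSub k (S i) 1) →ₗ[k] ({i | S i = Set.univ} →₀ k) :=
  DirectSum.toModule k ι _ fun i =>
    if h : S i = Set.univ then (Finsupp.lsingle ⟨i, h⟩).comp (indSub k (S i) 1).subtype else 0

/-- Inclusion of the full-interval coordinates. -/
def fincl (k : Type) [Field k] {ι : Type} (S : ι → Set (Fin 3)) (t : Fin 3) :
    ({i | S i = Set.univ} →₀ k) →ₗ[k] (DirectSum ι fun i => indSub k (S i) t) :=
  Finsupp.lsum k fun i => (DirectSum.lof k ι (fun i => indSub k (S i) t) i.1).comp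
    (LinearMap.codRestrict (indSub k (S i.1) t) LinearMap.id
      (fun x h => absurd (by rw [i.2]; trivial) h))

theorem fproj_fincl (k : Type) [Field k] {ι : Type} (S : ι → Set (Fin 3)) :
    (fproj k S).comp (fincl k S 1) = LinearMap.id := by
  refine Finsupp.lhom_ext' fun i => LinearMap.ext fun y => ?_
  have hi : S i.1 = Set.univ := i.2
  simp only [LinearMap.comp_apply, fincl, Finsupp.lsingle_apply, Finsupp.lsum_single,
    fproj, DirectSum.toModule_lof, LinearMap.id_apply]
  rw [dif_pos hi]
  rfl

theorem fincl_fproj (k : Type) [Field k] {ι : Type} (S : ι → Set (Fin 3))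
    (x : DirectSum ι fun i => indSub k (S i) 1) (i : ι) :
    fincl k S 1 (fproj k S x) i = if S i = Set.univ then x i else 0 := by
  have : (DirectSum.component k ι _ i).comp ((fincl k S 1).comp (fproj k S))
      = (if S i = Set.univ then LinearMap.id else 0 : indSub k (S i) 1 →ₗ[k] indSub k (S i) 1).comp
        (DirectSum.component k ι _ i) := by
    refine DirectSum.linearMap_ext k fun j => LinearMap.ext fun y => ?_
    simp only [LinearMap.comp_apply, fproj, DirectSum.toModule_lof]
    by_cases hj : S j = Set.univ
    · rw [dif_pos hj]
      simp only [LinearMap.comp_apply, fincl, Finsupp.lsingle_apply, Finsupp.lsum_single,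
        DirectSum.component.of]
      by_cases h : j = i
      · subst h; simp [hj]; rfl
      · simp [h]
    · rw [dif_neg hj]
      simp only [LinearMap.zero_apply, map_zero, DirectSum.component.of]
      by_cases h : j = i
      · subst h; simp [hj]
      · simp [h]
  have := LinearMap.congr_fun this x
  simp only [LinearMap.comp_apply] at this
  refine this.trans ?_
  split_ifs <;> rfl

theorem dmap_fincl (k : Type) [Field k] {ι : Type} (S : ι → Set (Fin 3)) (s t : Fin 3) :
    (dmap fun i => indMap k (S i) s t).comp (fincl k S s) = fincl k S t := by
  refine Finsupp.lhom_ext' fun i => LinearMap.ext fun y => ?_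
  have hi : S i.1 = Set.univ := i.2
  simp only [LinearMap.comp_apply, fincl, Finsupp.lsingle_apply, Finsupp.lsum_single,
    dmap, DirectSum.toModule_lof]
  congr 1
  apply Subtype.ext
  rw [indMap_coe]
  simp [hi]
  rfl

theorem finrank_F (k : Type) [Field k] {ι : Type} (F : Set ι) :
    Module.finrank k (F →₀ k) = F.ncard := by
  rw [Module.finrank_eq_nat_card_basis (Finsupp.basisSingleOne (R := k) (ι := F))]
  rfl

theorem indMap_zero {k : Type} [Field k] {Q : Set (Fin 3)} {s t : Fin 3} (h : ¬ (s ∈ Q ∧ t ∈ Q))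
    (x : indSub k Q s) : indMap k Q s t x = 0 := by
  apply Subtype.ext
  rw [indMap_coe, if_neg h]; rfl

theorem indMap_eq_zero {k : Type} [Field k] {Q : Set (Fin 3)} {s t : Fin 3} (hs : s ∈ Q)
    (ht : t ∈ Q) {x : indSub k Q s} (hx : indMap k Q s t x = 0) : x = 0 := by
  apply Subtype.ext
  have := congrArg Subtype.val hx
  rwa [indMap_coe, if_pos ⟨hs, ht⟩] at this

/-- Let `α : A → B`, `β : A → C`, `γ : B → D`, `δ : C → D` be linear
maps between finite-dimensional vector spaces with `γ ∘ α = δ ∘ β`.  (1) For any interval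
decomposition of the zigzag `C →δ D ←γ B` (vertex `0` carrying `C`, vertex `1` carrying
`D` and vertex `2` carrying `B`), `dim (Im γ ∩ Im δ)` is the multiplicity of the full
interval.  (2) For any interval decomposition of the zigzag `C ←β A →α B` (vertex `1`
carrying `A`), `dim (Ker α + Ker β) = dim A` minus the multiplicity of the full
interval. -/
theorem zigzag_full_interval_multiplicity (k : Type) [Field k]
    (A B C D : Type)
    [AddCommGroup A] [Module k A] [FiniteDimensional k A]
    [AddCommGroup B] [Module k B] [FiniteDimensional k B]
    [AddCommGroup C] [Module k C] [FiniteDimensional k C]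
    [AddCommGroup D] [Module k D] [FiniteDimensional k D]
    (α : A →ₗ[k] B) (β : A →ₗ[k] C) (γ : B →ₗ[k] D) (δ : C →ₗ[k] D)
    (hcomm : γ.comp α = δ.comp β) :
    (∀ (ι : Type) (S : ι → Set (Fin 3)), (∀ i, S i ∈ zigzagIntervals) →
      ∀ (eC : C ≃ₗ[k] DirectSum ι fun i => indSub k (S i) 0) (eD : D ≃ₗ[k] DirectSum ι fun i => indSub k (S i) 1)
        (eB : B ≃ₗ[k] DirectSum ι fun i => indSub k (S i) 2),
        eD.toLinearMap.comp δ = (dmap fun i => indMap k (S i) 0 1).comp eC.toLinearMap →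
        eD.toLinearMap.comp γ = (dmap fun i => indMap k (S i) 2 1).comp eB.toLinearMap →
        Module.finrank k ↥(LinearMap.range γ ⊓ LinearMap.range δ) =
          {i | S i = Set.univ}.ncard) ∧
    (∀ (ι : Type) (S : ι → Set (Fin 3)), (∀ i, S i ∈ zigzagIntervals) →
      ∀ (eC : C ≃ₗ[k] DirectSum ι fun i => indSub k (S i) 0) (eA : A ≃ₗ[k] DirectSum ι fun i => indSub k (S i) 1)
        (eB : B ≃ₗ[k] DirectSum ι fun i => indSub k (S i) 2),
        eC.toLinearMap.comp β = (dmap fun i => indMap k (S i) 1 0).comp eA.toLinearMap →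
        eB.toLinearMap.comp α = (dmap fun i => indMap k (S i) 1 2).comp eA.toLinearMap →
        (Module.finrank k ↥(LinearMap.ker α ⊔ LinearMap.ker β) : ℤ) =
          (Module.finrank k A : ℤ) - {i | S i = Set.univ}.ncard) := by
  constructor
  · intro ι S _ eC eD eB hδ hγ
    have hδ' : ∀ c i, eD (δ c) i = indMap k (S i) 0 1 (eC c i) := fun c i => by
      rw [← dmap_apply' (fun i => indMap k (S i) 0 1) (eC c) i]
      exact congrArg (fun z => z i) (LinearMap.congr_fun hδ c)
    have hγ' : ∀ c i, eD (γ c) i = indMap k (S i) 2 1 (eB c i) := fun c i => by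
      rw [← dmap_apply' (fun i => indMap k (S i) 2 1) (eB c) i]
      exact congrArg (fun z => z i) (LinearMap.congr_fun hγ c)
    have key : LinearMap.range γ ⊓ LinearMap.range δ
        = LinearMap.range (eD.symm.toLinearMap.comp (fincl k S 1)) := by
      apply le_antisymm
      · rintro y ⟨⟨b, rfl⟩, ⟨c, hc⟩⟩
        refine ⟨fproj k S (eD (γ b)), ?_⟩
        simp only [LinearMap.comp_apply, LinearEquiv.coe_coe]
        rw [LinearEquiv.symm_apply_eq]
        refine DFinsupp.ext fun i => ?_
        refine (fincl_fproj k S _ i).trans ?_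
        split_ifs with h
        · rfl
        · by_cases h2 : 2 ∈ S i ∧ 1 ∈ S i
          · have h0 : ¬ (0 ∈ S i ∧ 1 ∈ S i) := fun h0 => h (univ_of h0.1 h0.2 h2.1)
            rw [← hc]
            exact ((hδ' c i).trans (indMap_zero h0 _)).symm
          · exact ((hγ' b i).trans (indMap_zero h2 _)).symm
      · rintro y ⟨f, rfl⟩
        refine ⟨⟨eB.symm (fincl k S 2 f), ?_⟩, ⟨eC.symm (fincl k S 0 f), ?_⟩⟩
        · simp only [LinearMap.comp_apply, LinearEquiv.coe_coe]
          rw [LinearEquiv.eq_symm_apply]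
          have := LinearMap.congr_fun hγ (eB.symm (fincl k S 2 f))
          simp only [LinearMap.comp_apply, LinearEquiv.coe_coe, LinearEquiv.apply_symm_apply] at this
          rw [this]
          exact LinearMap.congr_fun (dmap_fincl k S 2 1) f
        · simp only [LinearMap.comp_apply, LinearEquiv.coe_coe]
          rw [LinearEquiv.eq_symm_apply]
          have := LinearMap.congr_fun hδ (eC.symm (fincl k S 0 f))
          simp only [LinearMap.comp_apply, LinearEquiv.coe_coe, LinearEquiv.apply_symm_apply] at this
          rw [this]
          exact LinearMap.congr_fun (dmap_fincl k S 0 1) f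
    rw [key, LinearMap.finrank_range_of_inj, finrank_F]
    rw [LinearMap.coe_comp]
    refine eD.symm.injective.comp ?_
    exact Function.LeftInverse.injective (g := fproj k S)
      (fun f => LinearMap.congr_fun (fproj_fincl k S) f)
  · intro ι S _ eC eA eB hβ hα
    have hβ' : ∀ c i, eC (β c) i = indMap k (S i) 1 0 (eA c i) := fun c i => by
      rw [← dmap_apply' (fun i => indMap k (S i) 1 0) (eA c) i]
      exact congrArg (fun z => z i) (LinearMap.congr_fun hβ c)
    have hα' : ∀ c i, eB (α c) i = indMap k (S i) 1 2 (eA c i) := fun c i => by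
      rw [← dmap_apply' (fun i => indMap k (S i) 1 2) (eA c) i]
      exact congrArg (fun z => z i) (LinearMap.congr_fun hα c)
    have hker : ∀ a, (∀ i, S i = Set.univ → eA a i = 0) →
        a ∈ LinearMap.ker ((fproj k S).comp eA.toLinearMap) := fun a ha => by
      rw [LinearMap.mem_ker]
      have h0 : fincl k S 1 (fproj k S (eA a)) = 0 := by
        refine DFinsupp.ext fun i => (fincl_fproj k S _ i).trans ?_
        split_ifs with h
        · exact ha i h
        · rfl
      have h1 := LinearMap.congr_fun (fproj_fincl k S) (fproj k S (eA a))
      simp only [LinearMap.comp_apply, LinearMap.id_apply, h0, map_zero] at h1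
      exact h1.symm
    have key : LinearMap.ker α ⊔ LinearMap.ker β
        = LinearMap.ker ((fproj k S).comp eA.toLinearMap) := by
      apply le_antisymm
      · refine sup_le ?_ ?_
        · intro a ha
          refine hker a fun i hi => ?_
          have h := hα' a i
          rw [LinearMap.mem_ker.1 ha, map_zero] at h
          exact indMap_eq_zero (by simp [hi]) (by simp [hi]) h.symm
        · intro a ha
          refine hker a fun i hi => ?_
          have h := hβ' a i
          rw [LinearMap.mem_ker.1 ha, map_zero] at h
          exact indMap_eq_zero (by simp [hi]) (by simp [hi]) h.symm
      · intro a ha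
        have hz : ∀ i, S i = Set.univ → eA a i = 0 := fun i hi => by
          have h := fincl_fproj k S (eA a) i
          rw [if_pos hi] at h
          rw [← h]
          have h2 : fproj k S (eA a) = 0 := ha
          rw [h2, map_zero]; rfl
        let u : DirectSum ι fun i => indSub k (S i) 1 :=
          DFinsupp.filter (fun i => 2 ∉ S i) (eA a)
        have hu : ∀ i, u i = if 2 ∉ S i then eA a i else 0 := fun i =>
          DFinsupp.filter_apply _ _ _
        refine Submodule.mem_sup.2 ⟨eA.symm u, ?_, a - eA.symm u, ?_, by abel⟩
        · rw [LinearMap.mem_ker, ← eB.map_eq_zero_iff]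
          refine DFinsupp.ext fun i => (hα' _ i).trans ?_
          rw [LinearEquiv.apply_symm_apply, hu]
          split_ifs with h
          · exact map_zero _
          · exact indMap_zero (fun h' => h h'.2) _
        · rw [LinearMap.mem_ker, ← eC.map_eq_zero_iff]
          refine DFinsupp.ext fun i => (hβ' _ i).trans ?_
          rw [map_sub, LinearEquiv.apply_symm_apply]
          have h1 : (eA a - u) i = eA a i - u i := rfl
          rw [h1, hu]
          split_ifs with h
          swap
          · rw [sub_self]; exact map_zero _
          · rw [sub_zero]
            by_cases h3 : 1 ∈ S i ∧ 0 ∈ S i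
            · rw [hz i (univ_of h3.2 h3.1 h)]; exact map_zero _
            · exact indMap_zero h3 _
    have hr := LinearMap.finrank_range_add_finrank_ker ((fproj k S).comp eA.toLinearMap)
    have hs : LinearMap.range ((fproj k S).comp eA.toLinearMap) = ⊤ := by
      rw [LinearMap.range_eq_top, LinearMap.coe_comp]
      refine Function.Surjective.comp ?_ eA.surjective
      exact Function.RightInverse.surjective (g := fincl k S 1)
        (fun f => LinearMap.congr_fun (fproj_fincl k S) f)
    rw [hs, finrank_top, finrank_F] at hr
    rw [key]
    omega

end PersistencePaper
end
end
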